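/- arXiv:1909.13678 — 7 statements merged into one kernel-verified Lean document; each statement's English description precedes it below -/
import Mathlib

section
/- For every n ≥ 1, the number f^J_n of nonempty chains of subsets of Fin (n²) that contain the full set Finset.univ as an element equals 1 + Σ_{k=1}^{n²} of the sum, over all integer tuples (c₀, …, c_{k−1}) with 0 ≤ c₀ < ⋯ < c_{k−1} < n², of C(n², c₀) · ∏_{j=1}^{k} C(n² − c_{j−1}, c_j − c_{j−1}) where c_k := n². -/
open Finset in
lemma aux_supersets (m d : ℕ) (A : Finset (Fin m)) (h : #A ≤ d) :
    #(univ.filter (fun B : Finset (Fin m) => #B = d ∧ A ⊆ B)) = (m - #A).choose (d - #A) := by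
  have h1 : #(univ \ A) = m - #A := by
    rw [card_sdiff_of_subset (subset_univ _)]; simp
  rw [← h1, ← card_powersetCard]
  refine card_bij' (fun B _ => B \ A) (fun B _ => B ∪ A) ?_ ?_ ?_ ?_
  · intro B hB
    simp only [mem_filter, mem_univ, true_and] at hB
    rw [mem_powersetCard, card_sdiff_of_subset hB.2, hB.1]
    exact ⟨sdiff_subset_sdiff (subset_univ _) subset_rfl, rfl⟩
  · intro B hB
    rw [mem_powersetCard] at hB
    simp only [mem_filter, mem_univ, true_and]
    refine ⟨?_, subset_union_right⟩
    rw [card_union_of_disjoint, hB.2]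
    · omega
    · exact disjoint_of_subset_left hB.1 sdiff_disjoint
  · intro B hB
    simp only [mem_filter, mem_univ, true_and] at hB
    exact sdiff_union_of_subset hB.2
  · intro B hB
    rw [mem_powersetCard] at hB
    have hd : Disjoint B A := disjoint_of_subset_left hB.1 sdiff_disjoint
    rw [union_sdiff_right, sdiff_eq_self_of_disjoint hd]

open Finset in
lemma aux_count (m k : ℕ) (c : Fin (k + 1) → ℕ) (hc : ∀ j : Fin k, c j.castSucc ≤ c j.succ) :
    #(univ.filter (fun f : Fin (k + 1) → Finset (Fin m) =>
      (∀ j, #(f j) = c j) ∧ ∀ j : Fin k, f j.castSucc ⊆ f j.succ)) =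
    m.choose (c 0) * ∏ j : Fin k, (m - c j.castSucc).choose (c j.succ - c j.castSucc) := by
  induction k with
  | zero =>
    haveI : Subsingleton (Fin (0 + 1)) := inferInstanceAs (Subsingleton (Fin 1))
    have := card_powersetCard (c 0) (univ : Finset (Fin m))
    simp only [card_univ, Fintype.card_fin] at this
    simp only [univ_eq_empty, prod_empty, mul_one]
    rw [← this]
    refine card_bij' (fun f _ => f 0) (fun B _ => fun _ => B) ?_ ?_ ?_ ?_
    · intro f hf
      simp only [mem_filter, mem_univ, true_and] at hf
      simp [mem_powersetCard, hf.1]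
    · intro B hB
      rw [mem_powersetCard] at hB
      simp only [mem_filter, mem_univ, true_and]
      refine ⟨fun j => ?_, fun j => j.elim0⟩
      rw [hB.2, Subsingleton.elim j 0]
    · intro f hf
      funext j
      rw [Subsingleton.elim j 0]
    · intro B hB
      rfl
  | succ k ih =>
    have ih' := ih (fun j => c j.castSucc) (fun j => by
      have := hc j.castSucc
      rwa [Fin.succ_castSucc] at this)
    rw [Fin.prod_univ_castSucc, ← mul_assoc]
    simp only [Fin.castSucc_zero, ← Fin.succ_castSucc] at ih' ⊢
    rw [← ih']
    rw [card_eq_sum_card_fiberwise (f := fun f => fun j : Fin (k+1) => f j.castSucc)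
      (t := univ.filter (fun f : Fin (k + 1) → Finset (Fin m) =>
      (∀ j, #(f j) = c j.castSucc) ∧ ∀ j : Fin k, f j.castSucc ⊆ f j.succ))]
    · rw [← smul_eq_mul, ← sum_const]
      refine sum_congr rfl ?_
      intro g hg
      simp only [mem_filter, mem_univ, true_and] at hg
      have hs := aux_supersets m (c (Fin.last (k+1))) (g (Fin.last k)) (by
        rw [hg.1]; exact hc (Fin.last k))
      rw [hg.1] at hs
      rw [Fin.succ_last, ← hs]
      refine card_bij' (fun f _ => f (Fin.last _)) (fun B _ => Fin.snoc (α := fun _ => Finset (Fin m)) g B) ?_ ?_ ?_ ?_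
      · intro f hf
        simp only [mem_filter, mem_univ, true_and] at hf ⊢
        obtain ⟨⟨h1, h2⟩, h3⟩ := hf
        refine ⟨h1 _, ?_⟩
        rw [← h3]
        exact h2 (Fin.last k)
      · intro B hB
        simp only [mem_filter, mem_univ, true_and] at hB ⊢
        refine ⟨⟨fun j => ?_, fun j => ?_⟩, ?_⟩
        · refine Fin.lastCases ?_ (fun j => ?_) j
          · simp [hB.1]
          · simp [hg.1]
        · refine Fin.lastCases ?_ (fun j => ?_) j
          · rw [Fin.succ_last, Fin.snoc_last, Fin.snoc_castSucc]; exact hB.2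
          · rw [Fin.succ_castSucc, Fin.snoc_castSucc, Fin.snoc_castSucc]; exact hg.2 j
        · funext j; simp
      · intro f hf
        simp only [mem_filter, mem_univ, true_and] at hf
        rw [← hf.2]
        exact Fin.snoc_init_self f
      · intro B hB
        simp
    · intro f hf
      simp only [coe_filter, mem_univ, true_and, Set.mem_ofPred_eq] at hf ⊢
      exact ⟨fun j => hf.1 _, fun j => hf.2 j.castSucc⟩

open Finset in
lemma aux_tuples (m k : ℕ) :
    #(univ.filter (fun f : Fin (k + 1) → Finset (Fin m) => StrictMono f ∧ f (Fin.last k) = univ)) =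
    ∑ c ∈ Finset.univ.filter
            (fun c : Fin (k + 1) → Fin (m + 1) =>
              c (Fin.last k) = Fin.last m ∧
                ∀ j : Fin k, c j.castSucc < c j.succ),
          m.choose (c 0) *
            ∏ j : Fin k,
              (m - (c j.castSucc : ℕ)).choose
                ((c j.succ : ℕ) - (c j.castSucc : ℕ)) := by
  have hlt : ∀ A : Finset (Fin m), #A < m + 1 := fun A =>
    Nat.lt_succ_of_le (by simpa using card_le_univ A)
  rw [card_eq_sum_card_fiberwise (f := fun f => fun j : Fin (k+1) => (⟨#(f j), hlt _⟩ : Fin (m+1)))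
      (t := Finset.univ.filter
            (fun c : Fin (k + 1) → Fin (m + 1) =>
              c (Fin.last k) = Fin.last m ∧
                ∀ j : Fin k, c j.castSucc < c j.succ))]
  · refine sum_congr rfl ?_
    intro c hc
    simp only [mem_filter, mem_univ, true_and] at hc
    rw [← aux_count m k (fun j => (c j : ℕ)) (fun j => (hc.2 j).le)]
    congr 1
    ext f
    simp only [mem_filter, mem_univ, true_and]
    constructor
    · rintro ⟨⟨h1, h2⟩, h3⟩
      refine ⟨fun j => ?_, fun j => (h1 (Fin.castSucc_lt_succ)).1⟩
      rw [← h3]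
    · rintro ⟨h1, h2⟩
      refine ⟨⟨?_, ?_⟩, ?_⟩
      · rw [Fin.strictMono_iff_lt_succ]
        intro j
        refine lt_of_le_of_ne (h2 j) (fun h => ?_)
        have := hc.2 j
        rw [Fin.lt_def, ← h1, ← h1, h] at this
        exact lt_irrefl _ this
      · rw [← card_eq_iff_eq_univ, h1, hc.1]; simp
      · funext j
        exact Fin.ext (h1 j)
  · intro f hf
    simp only [coe_filter, mem_univ, true_and, Set.mem_ofPred_eq] at hf ⊢
    refine ⟨?_, fun j => ?_⟩
    · apply Fin.ext; simp [hf.2]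
    · rw [Fin.lt_def]
      exact card_lt_card (hf.1 Fin.castSucc_lt_succ)

open Finset in
lemma aux_inj {m : ℕ} {C : Finset (Finset (Fin m))}
    (hC : IsChain (· ⊆ ·) (C : Set (Finset (Fin m)))) {A B : Finset (Fin m)}
    (hA : A ∈ C) (hB : B ∈ C) (h : #A ≤ #B) : A ⊆ B := by
  by_cases hAB : A = B
  · exact hAB.subset
  rcases hC hA hB hAB with h1 | h1
  · exact h1
  · exact (eq_of_subset_of_card_le h1 h).symm.subset

open Finset in
lemma aux_chains (m k : ℕ) :
    #(univ.filter (fun f : Fin (k + 1) → Finset (Fin m) => StrictMono f ∧ f (Fin.last k) = univ)) =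
    Nat.card {C : Finset (Finset (Fin m)) //
        (IsChain (· ⊆ ·) (C : Set (Finset (Fin m))) ∧ Finset.univ ∈ C) ∧ #C = k + 1} := by
  classical
  rw [Nat.card_eq_fintype_card, Fintype.card_subtype]
  refine card_bij (fun f _ => univ.image f) ?_ ?_ ?_
  · intro f hf
    simp only [mem_filter, mem_univ, true_and] at hf ⊢
    refine ⟨⟨?_, ?_⟩, ?_⟩
    · intro A hA B hB _
      simp only [coe_image, coe_univ, Set.image_univ, Set.mem_range] at hA hB
      obtain ⟨i, rfl⟩ := hA
      obtain ⟨j, rfl⟩ := hB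
      rcases le_total i j with h | h
      · exact Or.inl (hf.1.monotone h)
      · exact Or.inr (hf.1.monotone h)
    · exact mem_image.2 ⟨_, mem_univ _, hf.2⟩
    · rw [card_image_of_injective _ hf.1.injective]; simp
  · intro f hf g hg h
    simp only [mem_filter, mem_univ, true_and] at hf hg
    rw [← StrictMono.range_inj hf.1 hg.1]
    have := congrArg (fun s : Finset (Finset (Fin m)) => (s : Set (Finset (Fin m)))) h
    simpa using this
  · intro C hC
    simp only [mem_filter, mem_univ, true_and] at hC
    obtain ⟨⟨h1, h2⟩, h3⟩ := hC
    have hT : #(C.image card) = k + 1 := by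
      rw [card_image_of_injOn, h3]
      intro A hA B hB hAB
      exact (aux_inj h1 hA hB hAB.le).antisymm (aux_inj h1 hB hA hAB.ge)
    have hex : ∀ i : Fin (k+1), ∃ A ∈ C, #A = (C.image card).orderEmbOfFin hT i := fun i =>
      mem_image.1 (orderEmbOfFin_mem _ hT i)
    choose f hf hfc using hex
    have hmono : StrictMono f := by
      intro i j hij
      have hlt : #(f i) < #(f j) := by
        rw [hfc, hfc]; exact (OrderEmbedding.strictMono _) hij
      refine lt_of_le_of_ne (aux_inj h1 (hf i) (hf j) hlt.le) (fun h => ?_)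
      rw [h] at hlt
      exact lt_irrefl _ hlt
    have him : univ.image f = C := by
      apply eq_of_subset_of_card_le
      · intro A hA
        obtain ⟨i, _, rfl⟩ := mem_image.1 hA
        exact hf i
      · rw [card_image_of_injective _ hmono.injective, h3]; simp
    refine ⟨f, ?_, him⟩
    simp only [mem_filter, mem_univ, true_and]
    refine ⟨hmono, ?_⟩
    rw [← him] at h2
    obtain ⟨i, _, hi⟩ := mem_image.1 h2
    exact univ_subset_iff.1 (hi ▸ hmono.monotone (Fin.le_last i))

open Finset in
lemma aux_main (m : ℕ) :
    Nat.card {C : Finset (Finset (Fin m)) //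
        C.Nonempty ∧ IsChain (· ⊆ ·) (C : Set (Finset (Fin m))) ∧ Finset.univ ∈ C} =
    ∑ k ∈ range (m + 1), #(univ.filter
      (fun f : Fin (k + 1) → Finset (Fin m) => StrictMono f ∧ f (Fin.last k) = univ)) := by
  classical
  simp only [aux_chains]
  simp only [Nat.card_eq_fintype_card, Fintype.card_subtype]
  rw [card_eq_sum_card_fiberwise (f := fun C => #C - 1) (t := range (m + 1))]
  · refine sum_congr rfl fun k _ => ?_
    congr 1
    ext C
    simp only [mem_filter, mem_univ, true_and]
    constructor
    · rintro ⟨⟨h1, h2⟩, h3⟩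
      have := card_pos.2 h1
      exact ⟨h2, by omega⟩
    · rintro ⟨h2, h3⟩
      exact ⟨⟨⟨_, h2.2⟩, h2⟩, by omega⟩
  · intro C hC
    simp only [coe_filter, mem_univ, true_and, Set.mem_ofPred_eq] at hC
    obtain ⟨h0, h1, h2⟩ := hC
    have hT : #(C.image card) = #C := by
      rw [card_image_of_injOn]
      intro A hA B hB hAB
      exact (aux_inj h1 hA hB hAB.le).antisymm (aux_inj h1 hB hA hAB.ge)
    have : C.image card ⊆ range (m + 1) := by
      intro x hx
      obtain ⟨A, _, rfl⟩ := mem_image.1 hx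
      exact mem_range.2 (Nat.lt_succ_of_le (by simpa using card_le_univ A))
    have := card_le_card this
    rw [card_range, hT] at this
    simp only [coe_range, Set.mem_Iio]
    omega

/-- Corollary 3.8: the number of nonempty chains of subsets of `Fin (n²)`
containing `Finset.univ` equals `1 + Σ_{k=1}^{n²}` of the sum over tuples with `c_k = n²`
and `0 ≤ c₀ < ⋯ < c_{k-1} < c_k` of `C(n², c₀) * ∏_{j=1}^{k} C(n² - c_{j-1}, c_j - c_{j-1})`. -/
theorem stmt7 (n : ℕ) (hn : 1 ≤ n) :
    Nat.card {C : Finset (Finset (Fin (n ^ 2))) //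
        C.Nonempty ∧ IsChain (· ⊆ ·) (C : Set (Finset (Fin (n ^ 2)))) ∧
          Finset.univ ∈ C} =
      1 + ∑ k ∈ Finset.Icc 1 (n ^ 2),
        ∑ c ∈ Finset.univ.filter
            (fun c : Fin (k + 1) → Fin (n ^ 2 + 1) =>
              c (Fin.last k) = Fin.last (n ^ 2) ∧
                ∀ j : Fin k, c j.castSucc < c j.succ),
          (n ^ 2).choose (c 0) *
            ∏ j : Fin k,
              (n ^ 2 - (c j.castSucc : ℕ)).choose
                ((c j.succ : ℕ) - (c j.castSucc : ℕ)) := by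
  haveI : Subsingleton (Fin (0 + 1)) := inferInstanceAs (Subsingleton (Fin 1))
  rw [aux_main]
  simp only [aux_tuples]
  rw [Finset.range_eq_Ico, Finset.sum_eq_sum_Ico_succ_bot (Nat.succ_pos _)]
  congr 1
  rw [← aux_tuples, Finset.card_eq_one]
  refine ⟨fun _ => Finset.univ, ?_⟩
  ext f
  simp only [Finset.mem_filter, Finset.mem_univ, true_and, Finset.mem_singleton]
  constructor
  · rintro ⟨_, h⟩
    funext j
    rw [← h, Subsingleton.elim j (Fin.last 0)]
  · rintro rfl
    exact ⟨Subsingleton.strictMono _, rfl⟩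
end

section
/- The number of chains of length 3 of subsets of a 4-element set, i.e., strictly increasing functions c : Fin 4 → Finset (Fin 4) with respect to strict inclusion, equals 84. -/
/-- Chains of four sets as quadruples. -/
def chainEquiv : {c : Fin 4 → Finset (Fin 4) // StrictMono c} ≃
    {p : Finset (Fin 4) × Finset (Fin 4) × Finset (Fin 4) × Finset (Fin 4) //
      p.1 < p.2.1 ∧ p.2.1 < p.2.2.1 ∧ p.2.2.1 < p.2.2.2} where
  toFun c := ⟨(c.1 0, c.1 1, c.1 2, c.1 3),
    c.2 (by decide), c.2 (by decide), c.2 (by decide)⟩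
  invFun p := ⟨![p.1.1, p.1.2.1, p.1.2.2.1, p.1.2.2.2], by
    obtain ⟨⟨a, b, c, d⟩, h1, h2, h3⟩ := p
    rw [Fin.strictMono_iff_lt_succ]
    intro i
    fin_cases i
    · exact h1
    · exact h2
    · exact h3⟩
  left_inv c := by
    apply Subtype.ext
    funext i
    fin_cases i <;> rfl
  right_inv p := rfl

/-- Proper supersets. -/
theorem count_one : ∀ x : Finset (Fin 4),
    (∑ y : Finset (Fin 4), if x < y then 1 else 0) = ![15, 7, 3, 1, 0] (Fin.ofNat 5 x.card) := by
  decide +kernel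

theorem count_two : ∀ x : Finset (Fin 4),
    (∑ y : Finset (Fin 4), if x < y then ![15, 7, 3, 1, 0] (Fin.ofNat 5 y.card) else 0)
      = ![50, 12, 2, 0, 0] (Fin.ofNat 5 x.card) := by
  decide +kernel

theorem count_three : (∑ x : Finset (Fin 4), ∑ y : Finset (Fin 4),
    if x < y then ![50, 12, 2, 0, 0] (Fin.ofNat 5 y.card) else 0) = 84 := by
  decide +kernel

/-- `f_{2,3} = 84`. -/
theorem stmt10 : Nat.card {c : Fin 4 → Finset (Fin 4) // StrictMono c} = 84 := by
  rw [Nat.card_congr chainEquiv, Nat.card_eq_fintype_card, Fintype.card_subtype,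
    Finset.card_filter]
  simp only [Fintype.sum_prod_type, ite_and]
  rw [← count_three]
  refine Finset.sum_congr rfl fun x _ => Finset.sum_congr rfl fun y _ => ?_
  split_ifs with h
  · rw [← count_two]
    refine Finset.sum_congr rfl fun z _ => ?_
    split_ifs with h'
    · exact count_one z
    · simp
  · simp
end

section
/- The number of nonempty chains of subsets of a 4-element set, i.e., nonempty finite families C : Finset (Finset (Fin 4)) totally ordered by inclusion, equals 299. -/
/-- Recursive count (with fuel `n`) of the chains whose elements come from a list. -/
def chainCount {α : Type} (r : α → α → Bool) : ℕ → List α → ℕ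
  | 0, _ => 1
  | _ + 1, [] => 1
  | n + 1, a :: l => chainCount r n l + chainCount r n (l.filter (r a))

open Classical in
/-- The recursion computes the number of chains contained in the list. -/
theorem chainCount_eq {α : Type} (s : α → α → Prop) (r : α → α → Bool)
    (hr : ∀ a b, r a b = true ↔ (s a b ∨ s b a)) (n : ℕ) :
    ∀ l : List α, l.length ≤ n → l.Nodup →
      (l.toFinset.powerset.filter (fun C : Finset α => IsChain s (C : Set α))).card
        = chainCount r n l := by
  induction n with
  | zero =>
    intro l hl _
    have : l = [] := List.length_eq_zero_iff.mp (by omega)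
    subst this
    simp [chainCount, Finset.filter_singleton]
  | succ n ih =>
    intro l hl hnd
    cases l with
    | nil => simp [chainCount, Finset.filter_singleton]
    | cons a l =>
      have hnd' := List.nodup_cons.mp hnd
      have hlen : l.length ≤ n := by simpa using hl
      have h1 := ih l hlen hnd'.2
      have h2 := ih (l.filter (r a)) ((List.length_filter_le _ _).trans hlen) (hnd'.2.filter _)
      rw [chainCount, ← h1, ← h2, List.toFinset_cons, Finset.powerset_insert,
        Finset.filter_union, Finset.card_union_of_disjoint]
      · congr 1
        symm
        apply Finset.card_bij (fun C _ => insert a C)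
        · intro C hC
          simp only [Finset.mem_filter, Finset.mem_powerset, Finset.mem_image] at hC ⊢
          refine ⟨⟨C, fun x hx => ?_, rfl⟩, ?_⟩
          · have := hC.1 hx
            simp only [List.mem_toFinset, List.mem_filter] at this ⊢
            exact this.1
          · rw [Finset.coe_insert]
            refine hC.2.insert fun b hb _ => ?_
            have := hC.1 hb
            simp only [List.mem_toFinset, List.mem_filter] at this
            exact (hr a b).mp this.2
        · intro C hC D hD h
          simp only [Finset.mem_filter, Finset.mem_powerset] at hC hD
          have ha : ∀ E : Finset α, E ⊆ (l.filter (r a)).toFinset → a ∉ E := by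
            intro E hE h
            have := hE h
            simp only [List.mem_toFinset, List.mem_filter] at this
            exact hnd'.1 this.1
          rw [← Finset.erase_insert (ha C hC.1), ← Finset.erase_insert (ha D hD.1), h]
        · intro C hC
          simp only [Finset.mem_filter, Finset.mem_powerset, Finset.mem_image] at hC
          obtain ⟨⟨D, hD, rfl⟩, hch⟩ := hC
          refine ⟨D, ?_, rfl⟩
          simp only [Finset.mem_filter, Finset.mem_powerset]
          rw [Finset.coe_insert] at hch
          refine ⟨fun x hx => ?_, hch.mono (Set.subset_insert _ _)⟩
          have hxl := List.mem_toFinset.mp (hD hx)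
          simp only [List.mem_toFinset, List.mem_filter]
          refine ⟨hxl, (hr a x).mpr ?_⟩
          refine hch (Set.mem_insert _ _) (Set.mem_insert_of_mem _ hx) ?_
          rintro rfl
          exact hnd'.1 hxl
      · rw [Finset.disjoint_left]
        intro C hC hC'
        simp only [Finset.mem_filter, Finset.mem_powerset, Finset.mem_image] at hC hC'
        obtain ⟨⟨D, _, rfl⟩, _⟩ := hC'
        exact hnd'.1 (List.mem_toFinset.mp (hC.1 (Finset.mem_insert_self a D)))

/-- All subsets of `Fin 4`. -/
def allSubsets : List (Finset (Fin 4)) :=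
  [∅, {0}, {1}, {2}, {3}, {0, 1}, {0, 2}, {0, 3}, {1, 2}, {1, 3}, {2, 3},
    {0, 1, 2}, {0, 1, 3}, {0, 2, 3}, {1, 2, 3}, {0, 1, 2, 3}]

set_option maxRecDepth 100000 in
theorem allSubsets_count :
    chainCount (fun a b : Finset (Fin 4) => decide (a ⊆ b ∨ b ⊆ a)) 16 allSubsets = 300 := by
  decide +kernel

/-- the number of nonempty chains of subsets of a 4-element set is `299`. -/
theorem stmt12 :
    Nat.card {C : Finset (Finset (Fin 4)) //
        C.Nonempty ∧ IsChain (· ⊆ ·) (C : Set (Finset (Fin 4)))} = 299 := by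
  classical
  have h := chainCount_eq (fun a b : Finset (Fin 4) => a ⊆ b)
    (fun a b => decide (a ⊆ b ∨ b ⊆ a)) (by simp) 16 allSubsets (by decide) (by decide +kernel)
  rw [allSubsets_count] at h
  have hu : ∀ x : Finset (Fin 4), x ∈ allSubsets := by decide +kernel
  rw [Nat.card_eq_fintype_card, Fintype.card_subtype]
  have he : (Finset.univ.filter fun C : Finset (Finset (Fin 4)) =>
      C.Nonempty ∧ IsChain (· ⊆ ·) (C : Set (Finset (Fin 4))))
      = (allSubsets.toFinset.powerset.filter
        (fun C : Finset (Finset (Fin 4)) => IsChain (fun a b => a ⊆ b) (C : Set (Finset (Fin 4))))).erase ∅ := by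
    ext C
    simp only [Finset.mem_filter, Finset.mem_univ, true_and, Finset.mem_erase,
      Finset.mem_powerset, Finset.nonempty_iff_ne_empty]
    constructor
    · rintro ⟨h1, h2⟩
      exact ⟨h1, fun x _ => List.mem_toFinset.mpr (hu x), h2⟩
    · rintro ⟨h1, _, h2⟩
      exact ⟨h1, h2⟩
  rw [he, Finset.card_erase_of_mem (by simp)]
  have : 299 = 300 - 1 := rfl
  rw [this, ← h]
  congr!
end

section
/- The number of nonempty chains of subsets of a 9-element set, i.e., nonempty finite families C : Finset (Finset (Fin 9)) totally ordered by inclusion, equals 28349043. -/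
open Classical in
/-- Chains of subsets whose greatest element is `s`. -/
noncomputable def chainsTop (s : Finset (Fin 9)) : Finset (Finset (Finset (Fin 9))) :=
  Finset.univ.filter (fun C => IsChain (· ⊆ ·) (C : Set (Finset (Fin 9))) ∧ s ∈ C ∧ ∀ t ∈ C, t ⊆ s)

theorem mem_chainsTop (s : Finset (Fin 9)) (C : Finset (Finset (Fin 9))) :
    C ∈ chainsTop s ↔
      IsChain (· ⊆ ·) (C : Set (Finset (Fin 9))) ∧ s ∈ C ∧ ∀ t ∈ C, t ⊆ s := by
  simp [chainsTop]

theorem chainsTop_disj {s t : Finset (Fin 9)} (h : s ≠ t) :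
    Disjoint (chainsTop s) (chainsTop t) := by
  rw [Finset.disjoint_left]
  intro C h1 h2
  rw [mem_chainsTop] at h1 h2
  exact h (Finset.Subset.antisymm (h2.2.2 _ h1.2.1) (h1.2.2 _ h2.2.1))

theorem exists_top (C : Finset (Finset (Fin 9))) (hne : C.Nonempty)
    (hC : IsChain (· ⊆ ·) (C : Set (Finset (Fin 9)))) : ∃ s, C ∈ chainsTop s := by
  obtain ⟨s, hs⟩ := C.exists_maximal hne
  refine ⟨s, (mem_chainsTop _ _).2 ⟨hC, hs.1, fun t ht => ?_⟩⟩
  rcases hC.total hs.1 ht with h | h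
  · exact hs.2 ht h
  · exact h

theorem chainsTop_eq (s : Finset (Fin 9)) :
    chainsTop s = insert {s} ((s.ssubsets.biUnion chainsTop).image (insert s)) := by
  ext C
  simp only [Finset.mem_insert, Finset.mem_image, Finset.mem_biUnion, Finset.mem_ssubsets]
  constructor
  · intro h
    rw [mem_chainsTop] at h
    obtain ⟨hC, hs, hm⟩ := h
    by_cases he : (C.erase s).Nonempty
    · right
      obtain ⟨t, ht⟩ := exists_top _ he (hC.mono (by
        intro x hx; exact Finset.mem_of_mem_erase hx))
      refine ⟨C.erase s, ⟨t, ?_, ht⟩, Finset.insert_erase hs⟩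
      have h2 := ((mem_chainsTop _ _).1 ht).2.1
      rw [Finset.mem_erase] at h2
      exact (hm t h2.2).ssubset_of_ne h2.1
    · left
      rw [Finset.not_nonempty_iff_eq_empty] at he
      rw [← Finset.insert_erase hs, he]
      rfl
  · rintro (rfl | ⟨D, ⟨t, hts, hD⟩, rfl⟩)
    · rw [mem_chainsTop]
      simp
    · rw [mem_chainsTop] at hD ⊢
      have key : ∀ u ∈ D, u ⊆ s := fun u hu => (hD.2.2 u hu).trans hts.subset
      refine ⟨?_, Finset.mem_insert_self _ _, ?_⟩
      · rw [Finset.coe_insert]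
        exact hD.1.insert (fun b hb _ => Or.inr (key b hb))
      · intro u hu
        rcases Finset.mem_insert.1 hu with rfl | hu
        · exact Finset.Subset.refl _
        · exact key u hu

theorem chainsTop_notMem {s t : Finset (Fin 9)} (h : t ⊂ s) {C : Finset (Finset (Fin 9))}
    (hC : C ∈ chainsTop t) : s ∉ C := fun hs =>
  h.not_subset (((mem_chainsTop _ _).1 hC).2.2 s hs)

theorem card_chainsTop (s : Finset (Fin 9)) :
    (chainsTop s).card = 1 + ∑ t ∈ s.ssubsets, (chainsTop t).card := by
  have hn : ∀ C ∈ s.ssubsets.biUnion chainsTop, s ∉ C := by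
    intro C hC
    obtain ⟨t, ht, hC⟩ := Finset.mem_biUnion.1 hC
    exact chainsTop_notMem (Finset.mem_ssubsets.1 ht) hC
  rw [chainsTop_eq, Finset.card_insert_of_notMem, Finset.card_image_of_injOn,
    Finset.card_biUnion, add_comm]
  · intro a _ b _ hab
    exact chainsTop_disj hab
  · intro C hC D hD h
    have h : insert s C = insert s D := h
    rw [← Finset.erase_insert (hn C hC), h, Finset.erase_insert (hn D hD)]
  · intro h
    obtain ⟨C, hC, h⟩ := Finset.mem_image.1 h
    have h1 := hn C hC
    obtain ⟨t, ht, hC⟩ := Finset.mem_biUnion.1 hC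
    have h2 : t ∈ insert s C := Finset.mem_insert_of_mem ((mem_chainsTop _ _).1 hC).2.1
    rw [h, Finset.mem_singleton] at h2
    rw [h2] at hC
    exact h1 ((mem_chainsTop _ _).1 hC).2.1

/-- Number of chains with a given greatest element of size `n`. -/
def topCount (n : ℕ) : ℕ := 1 + ∑ k : Fin n, n.choose k * topCount k

theorem card_chainsTop_eq (n : ℕ) : ∀ s : Finset (Fin 9), s.card = n →
    (chainsTop s).card = topCount n := by
  induction n using Nat.strong_induction_on with
  | _ n ih =>
    intro s hs
    rw [card_chainsTop, topCount]
    congr 1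
    have h1 : ∑ t ∈ s.ssubsets, (chainsTop t).card = ∑ t ∈ s.ssubsets, topCount t.card := by
      refine Finset.sum_congr rfl fun t ht => ih _ ?_ t rfl
      rw [← hs]
      exact Finset.card_lt_card (Finset.mem_ssubsets.1 ht)
    have h2 := Finset.sum_powerset_apply_card topCount (x := s)
    rw [Finset.sum_range_succ, hs, Nat.choose_self, one_smul] at h2
    have h3 : ∑ t ∈ s.ssubsets, topCount t.card + topCount s.card
        = ∑ t ∈ s.powerset, topCount t.card := by
      rw [Finset.ssubsets, Finset.sum_erase_add _ _ (Finset.mem_powerset_self s)]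
    rw [h1, Fin.sum_univ_eq_sum_range (fun k => n.choose k * topCount k) n]
    rw [h2, hs] at h3
    simpa using h3

theorem topCount_sum : ∑ m ∈ Finset.range 10, (9 : ℕ).choose m * topCount m = 28349043 := by
  have h0 : topCount 0 = 1 := by rw [topCount]; simp
  have h1 : topCount 1 = 2 := by rw [topCount]; simp [h0]
  have h2 : topCount 2 = 6 := by rw [topCount]; simp [Fin.sum_univ_succ, h0, h1]
  have h3 : topCount 3 = 26 := by
    rw [topCount, Fin.sum_univ_eq_sum_range (fun k => Nat.choose _ k * topCount k)]
    simp [Finset.sum_range_succ, h0, h1, h2, Nat.choose]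
  have h4 : topCount 4 = 150 := by
    rw [topCount, Fin.sum_univ_eq_sum_range (fun k => Nat.choose _ k * topCount k)]
    simp [Finset.sum_range_succ, h0, h1, h2, h3, Nat.choose]
  have h5 : topCount 5 = 1082 := by
    rw [topCount, Fin.sum_univ_eq_sum_range (fun k => Nat.choose _ k * topCount k)]
    simp [Finset.sum_range_succ, h0, h1, h2, h3, h4, Nat.choose]
  have h6 : topCount 6 = 9366 := by
    rw [topCount, Fin.sum_univ_eq_sum_range (fun k => Nat.choose _ k * topCount k)]
    simp [Finset.sum_range_succ, h0, h1, h2, h3, h4, h5, Nat.choose]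
  have h7 : topCount 7 = 94586 := by
    rw [topCount, Fin.sum_univ_eq_sum_range (fun k => Nat.choose _ k * topCount k)]
    simp [Finset.sum_range_succ, h0, h1, h2, h3, h4, h5, h6, Nat.choose]
  have h8 : topCount 8 = 1091670 := by
    rw [topCount, Fin.sum_univ_eq_sum_range (fun k => Nat.choose _ k * topCount k)]
    simp [Finset.sum_range_succ, h0, h1, h2, h3, h4, h5, h6, h7, Nat.choose]
  have h9 : topCount 9 = 14174522 := by
    rw [topCount, Fin.sum_univ_eq_sum_range (fun k => Nat.choose _ k * topCount k)]
    simp [Finset.sum_range_succ, h0, h1, h2, h3, h4, h5, h6, h7, h8, Nat.choose]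
  simp [Finset.sum_range_succ, h0, h1, h2, h3, h4, h5, h6, h7, h8, h9, Nat.choose]

/-- the number of nonempty chains of subsets of a 9-element set is `28349043`. -/
theorem stmt14 :
    Nat.card {C : Finset (Finset (Fin 9)) //
        C.Nonempty ∧ IsChain (· ⊆ ·) (C : Set (Finset (Fin 9)))} = 28349043 := by
  have hmem : ∀ C : Finset (Finset (Fin 9)),
      (C.Nonempty ∧ IsChain (· ⊆ ·) (C : Set (Finset (Fin 9)))) ↔
        C ∈ (Finset.univ : Finset (Fin 9)).powerset.biUnion chainsTop := by
    intro C
    rw [Finset.mem_biUnion]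
    constructor
    · rintro ⟨h1, h2⟩
      obtain ⟨s, hs⟩ := exists_top C h1 h2
      exact ⟨s, by simp, hs⟩
    · rintro ⟨s, _, hs⟩
      rw [mem_chainsTop] at hs
      exact ⟨⟨s, hs.2.1⟩, hs.1⟩
  rw [Nat.card_congr (Equiv.subtypeEquivRight hmem), Nat.subtype_card _ (fun _ => Iff.rfl),
    Finset.card_biUnion (fun a _ b _ hab => chainsTop_disj hab),
    Finset.sum_congr rfl (fun s _ => card_chainsTop_eq _ s rfl),
    Finset.sum_powerset_apply_card topCount]
  simpa using topCount_sum
end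

section
/- Let A and B be fuzzy matrices of order n (functions Fin n × Fin n → ℝ with values in [0,1]). Then A ≅ B under Murali's equivalence if and only if: for every α ∈ (0,1] there exists β ∈ (0,1] with A^α = B^β, and for every β ∈ (0,1] there exists α ∈ (0,1] with B^β = A^α, where A^α = {p | A p ≥ α} denotes the weak α-cut. -/
/-- Forward direction, one half. -/
theorem cut_forward {n : ℕ} (A B : Fin n × Fin n → ℝ)
    (hB : ∀ p, 0 ≤ B p ∧ B p ≤ 1)
    (h1 : ∀ p q, A p > A q ↔ B p > B q) (h2 : ∀ p, A p = 1 ↔ B p = 1)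
    (h3 : ∀ p, A p = 0 ↔ B p = 0) :
    ∀ α ∈ Set.Ioc (0 : ℝ) 1, ∃ β ∈ Set.Ioc (0 : ℝ) 1,
      {p | α ≤ A p} = {p | β ≤ B p} := by
  rintro α ⟨ha0, ha1⟩
  by_cases hne : ({p | α ≤ A p} : Set (Fin n × Fin n)).Nonempty
  · obtain ⟨p, hp, hmin⟩ := Set.exists_min_image _ A (Set.toFinite _) hne
    simp only [Set.mem_setOf_eq] at hp hmin
    have hp0 : B p ≠ 0 := fun h => by
      have := (h3 p).2 h
      linarith
    refine ⟨B p, ⟨lt_of_le_of_ne (hB p).1 hp0.symm, (hB p).2⟩, ?_⟩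
    ext q
    simp only [Set.mem_setOf_eq]
    have key : A p ≤ A q ↔ B p ≤ B q := by
      rw [← not_lt, ← not_lt]
      exact not_congr (h1 p q)
    exact ⟨fun h => key.1 (hmin q h), fun h => hp.trans (key.2 h)⟩
  · refine ⟨1, ⟨one_pos, le_rfl⟩, ?_⟩
    ext q
    simp only [Set.mem_setOf_eq]
    constructor
    · intro h
      exact absurd ⟨q, h⟩ hne
    · intro h
      have := (h2 q).2 (le_antisymm (hB q).2 h)
      linarith

/-- Backward direction: comparisons transfer. -/
theorem cut_backward {n : ℕ} (A B : Fin n × Fin n → ℝ)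
    (hA : ∀ p, 0 ≤ A p ∧ A p ≤ 1)
    (h : ∀ α ∈ Set.Ioc (0 : ℝ) 1, ∃ β ∈ Set.Ioc (0 : ℝ) 1,
      {p | α ≤ A p} = {p | β ≤ B p}) :
    (∀ p q, A p > A q → B p > B q) ∧ (∀ p, B p = 1 → A p = 1) ∧
      (∀ p, 0 < A p → 0 < B p) := by
  refine ⟨fun p q hpq => ?_, fun p hp => ?_, fun p hp => ?_⟩
  · obtain ⟨β, _, e⟩ := h (A p) ⟨lt_of_le_of_lt (hA q).1 hpq, (hA p).2⟩
    have e1 := Set.ext_iff.1 e p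
    have e2 := Set.ext_iff.1 e q
    simp only [Set.mem_setOf_eq] at e1 e2
    have := e1.1 le_rfl
    have : B q < β := not_le.1 fun h' => absurd (e2.2 h') (not_le.2 hpq)
    linarith
  · obtain ⟨β, hb, e⟩ := h 1 ⟨one_pos, le_rfl⟩
    have e1 := Set.ext_iff.1 e p
    simp only [Set.mem_setOf_eq] at e1
    exact le_antisymm (hA p).2 (e1.2 (hp ▸ hb.2))
  · obtain ⟨β, hb, e⟩ := h (A p) ⟨hp, (hA p).2⟩
    have e1 := Set.ext_iff.1 e p
    simp only [Set.mem_setOf_eq] at e1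
    exact lt_of_lt_of_le hb.1 (e1.1 le_rfl)

/-- Proposition 2.6: two fuzzy matrices are Murali-equivalent iff their
weak `α`-cuts for `α ∈ (0,1]` match up in both directions. -/
theorem stmt16 (n : ℕ) (A B : Fin n × Fin n → ℝ)
    (hA : ∀ p, 0 ≤ A p ∧ A p ≤ 1) (hB : ∀ p, 0 ≤ B p ∧ B p ≤ 1) :
    ((∀ p q, A p > A q ↔ B p > B q) ∧
        (∀ p, A p = 1 ↔ B p = 1) ∧
        (∀ p, A p = 0 ↔ B p = 0)) ↔
      ((∀ α ∈ Set.Ioc (0 : ℝ) 1, ∃ β ∈ Set.Ioc (0 : ℝ) 1,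
          {p | α ≤ A p} = {p | β ≤ B p}) ∧
        (∀ β ∈ Set.Ioc (0 : ℝ) 1, ∃ α ∈ Set.Ioc (0 : ℝ) 1,
          {p | β ≤ B p} = {p | α ≤ A p})) := by
  constructor
  · rintro ⟨h1, h2, h3⟩
    exact ⟨cut_forward A B hB h1 h2 h3,
      cut_forward B A hA (fun p q => (h1 p q).symm) (fun p => (h2 p).symm)
        (fun p => (h3 p).symm)⟩
  · rintro ⟨h, h'⟩
    obtain ⟨a1, a2, a3⟩ := cut_backward A B hA h
    obtain ⟨b1, b2, b3⟩ := cut_backward B A hB h'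
    refine ⟨fun p q => ⟨a1 p q, b1 p q⟩, fun p => ⟨b2 p, a2 p⟩, fun p => ⟨fun hp => ?_, fun hp => ?_⟩⟩
    · by_contra hc
      have := b3 p (lt_of_le_of_ne (hB p).1 (Ne.symm hc))
      linarith
    · by_contra hc
      have := a3 p (lt_of_le_of_ne (hA p).1 (Ne.symm hc))
      linarith
end

section
/- For every n ≥ 1, the map sending a fuzzy matrix A of order n to the family {A^α : α ∈ (0,1]} of its weak α-cuts descends to a well-defined bijection from the quotient of the set of fuzzy matrices of order n by Murali's equivalence relation onto the set of nonempty chains of subsets of Fin n × Fin n (nonempty families of subsets totally ordered by inclusion). In particular, the set of equivalence classes of fuzzy matrices of order n is finite. -/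
/-- A fuzzy matrix of order `n`: a function on positions with values in `[0,1]`. -/
def IsFuzzyMatrix (n : ℕ) (A : Fin n × Fin n → ℝ) : Prop :=
  ∀ p, 0 ≤ A p ∧ A p ≤ 1

/-- Murali's relation `≅` on fuzzy matrices of order `n`. -/
def MuraliEquiv (n : ℕ)
    (A B : {A : Fin n × Fin n → ℝ // IsFuzzyMatrix n A}) : Prop :=
  (∀ p q, A.1 p > A.1 q ↔ B.1 p > B.1 q) ∧
    (∀ p, A.1 p = 1 ↔ B.1 p = 1) ∧
    (∀ p, A.1 p = 0 ↔ B.1 p = 0)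

/-- The family of weak cuts of `A`. -/
def cutFamily {n : ℕ} (A : Fin n × Fin n → ℝ) : Set (Set (Fin n × Fin n)) :=
  {s | ∃ α ∈ Set.Ioc (0 : ℝ) 1, s = {p | α ≤ A p}}

theorem cutFamily_nonempty {n : ℕ} (A : Fin n × Fin n → ℝ) : (cutFamily A).Nonempty :=
  ⟨_, 1, by simp, rfl⟩

theorem cutFamily_chain {n : ℕ} (A : Fin n × Fin n → ℝ) :
    IsChain (· ⊆ ·) (cutFamily A) := by
  rintro s ⟨a, -, rfl⟩ t ⟨b, -, rfl⟩ -
  rcases le_total a b with h | h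
  · exact Or.inr fun p hp => h.trans hp
  · exact Or.inl fun p hp => h.trans hp

theorem lt_iff_cut {n : ℕ} {A : Fin n × Fin n → ℝ} (hA : IsFuzzyMatrix n A) (p q) :
    A q < A p ↔ ∃ s ∈ cutFamily A, p ∈ s ∧ q ∉ s := by
  constructor
  · intro h
    exact ⟨_, ⟨A p, ⟨(hA q).1.trans_lt h, (hA p).2⟩, rfl⟩, le_refl (A p), not_le.2 h⟩
  · rintro ⟨s, ⟨a, -, rfl⟩, hp, hq⟩
    exact (not_le.1 hq).trans_le hp

theorem one_iff_cut {n : ℕ} {A : Fin n × Fin n → ℝ} (hA : IsFuzzyMatrix n A) (p) :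
    A p = 1 ↔ ∀ s ∈ cutFamily A, p ∈ s := by
  constructor
  · rintro h s ⟨a, ha, rfl⟩
    exact ha.2.trans h.ge
  · intro h
    exact le_antisymm (hA p).2 (h {q | 1 ≤ A q} ⟨1, by simp, rfl⟩)

theorem zero_iff_cut {n : ℕ} {A : Fin n × Fin n → ℝ} (hA : IsFuzzyMatrix n A) (p) :
    A p = 0 ↔ ∀ s ∈ cutFamily A, p ∉ s := by
  constructor
  · rintro h s ⟨a, ha, rfl⟩ hp
    exact absurd (ha.1.trans_le hp) (by simp [h])
  · intro h
    by_contra h0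
    exact h {q | A p ≤ A q} ⟨A p, ⟨lt_of_le_of_ne (hA p).1 (Ne.symm h0), (hA p).2⟩, rfl⟩
      (le_refl (A p))

theorem cutFamily_sub {n : ℕ} {A B : {A : Fin n × Fin n → ℝ // IsFuzzyMatrix n A}}
    (h : MuraliEquiv n A B) : cutFamily A.1 ⊆ cutFamily B.1 := by
  obtain ⟨h1, h2, h3⟩ := h
  rintro s ⟨a, ha, rfl⟩
  by_cases hne : ∃ p, a ≤ A.1 p
  · obtain ⟨p, hp, hmin⟩ := Set.exists_min_image {p | a ≤ A.1 p} A.1 (Set.toFinite _) hne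
    refine ⟨B.1 p, ⟨?_, (B.2 p).2⟩, ?_⟩
    · refine lt_of_le_of_ne (B.2 p).1 fun h0 => ?_
      have := (h3 p).2 h0.symm
      have hp' : a ≤ A.1 p := hp
      linarith [ha.1]
    · ext q
      have h4 : A.1 p ≤ A.1 q ↔ B.1 p ≤ B.1 q := by
        simpa using not_congr (h1 p q)
      exact ⟨fun hq => h4.1 (hmin q hq), fun hq => le_trans hp (h4.2 hq)⟩
  · push Not at hne
    refine ⟨1, by simp, ?_⟩
    ext q
    have hb : ¬ (1 ≤ B.1 q) := fun hq => by
      have := (h2 q).2 (le_antisymm (B.2 q).2 hq)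
      linarith [hne q, ha.2]
    have := hne q
    simp only [Set.mem_ofPred_eq]
    exact ⟨fun hq => absurd hq (not_le.2 this), fun hq => absurd hq hb⟩

theorem MuraliEquiv.symm' {n : ℕ} {A B : {A : Fin n × Fin n → ℝ // IsFuzzyMatrix n A}}
    (h : MuraliEquiv n A B) : MuraliEquiv n B A :=
  ⟨fun p q => (h.1 p q).symm, fun p => (h.2.1 p).symm, fun p => (h.2.2 p).symm⟩

theorem cutFamily_surj {n : ℕ} (S : Set (Set (Fin n × Fin n))) (hS : S.Nonempty)
    (hc : IsChain (· ⊆ ·) S) : ∃ A, IsFuzzyMatrix n A ∧ cutFamily A = S := by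
  have hk : (0 : ℝ) < S.ncard := by
    exact_mod_cast (Set.ncard_pos (Set.toFinite S)).2 hS
  have mono : ∀ {X Y : Set (Set (Fin n × Fin n))}, X ⊆ Y → (X.ncard : ℝ) ≤ Y.ncard :=
    fun h => by exact_mod_cast Set.ncard_le_ncard h (Set.toFinite _)
  refine ⟨fun p => ({t ∈ S | p ∈ t}.ncard : ℝ) / S.ncard, fun p => ⟨by positivity, ?_⟩, ?_⟩
  · exact (div_le_one hk).2 (mono (Set.sep_subset _ _))
  ext s
  constructor
  · rintro ⟨a, ha, rfl⟩
    simp only [le_div_iff₀ hk]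
    obtain ⟨m, hm⟩ := (Set.toFinite S).exists_minimal hS
    have hmT : m ∈ {s ∈ S | a * S.ncard ≤ ({t ∈ S | s ⊆ t}.ncard : ℝ)} := by
      refine ⟨hm.1, ?_⟩
      have : (S.ncard : ℝ) ≤ ({t ∈ S | m ⊆ t}.ncard : ℝ) := mono fun t ht =>
        ⟨ht, (hc.total hm.1 ht).elim id fun h => hm.2 ht h⟩
      nlinarith [ha.2]
    obtain ⟨s, hs⟩ := (Set.toFinite _).exists_maximal ⟨m, hmT⟩
    convert hs.1.1 using 1
    ext p
    constructor
    · intro hp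
      have hp : a * S.ncard ≤ ({t ∈ S | p ∈ t}.ncard : ℝ) := hp
      have hpos : 0 < {t ∈ S | p ∈ t}.ncard := by
        have := mul_pos ha.1 hk
        exact_mod_cast this.trans_le hp
      obtain ⟨u, hu⟩ := (Set.toFinite _).exists_minimal
        ((Set.ncard_pos (Set.toFinite _)).1 hpos)
      have huT : u ∈ {s ∈ S | a * S.ncard ≤ ({t ∈ S | s ⊆ t}.ncard : ℝ)} :=
        ⟨hu.1.1, hp.trans (mono fun t ht =>
          ⟨ht.1, (hc.total hu.1.1 ht.1).elim id fun h => hu.2 ht h⟩)⟩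
      have : u ⊆ s := (hc.total hu.1.1 hs.1.1).elim id fun h => hs.2 huT h
      exact this hu.1.2
    · intro hp
      exact hs.1.2.trans (mono fun t ht => ⟨ht.1, ht.2 hp⟩)
  · intro hs
    have hpos : (0 : ℝ) < {t ∈ S | s ⊆ t}.ncard := by
      have hne : {t ∈ S | s ⊆ t}.Nonempty := ⟨s, hs, subset_rfl⟩
      exact_mod_cast (Set.ncard_pos (Set.toFinite _)).2 hne
    refine ⟨({t ∈ S | s ⊆ t}.ncard : ℝ) / S.ncard,
      ⟨by positivity, (div_le_one hk).2 (mono (Set.sep_subset _ _))⟩, ?_⟩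
    ext p
    simp only [Set.mem_ofPred_eq, div_le_div_iff_of_pos_right hk]
    constructor
    · intro hp
      exact mono fun t ht => ⟨ht.1, ht.2 hp⟩
    · intro h
      by_contra hp
      have hlt : {t ∈ S | p ∈ t}.ncard < {t ∈ S | s ⊆ t}.ncard := by
        refine Set.ncard_lt_ncard ⟨fun t ht => ⟨ht.1, ?_⟩, fun h' => ?_⟩ (Set.toFinite _)
        · exact (hc.total hs ht.1).elim id fun h' => absurd (h' ht.2) hp
        · exact hp (h' ⟨hs, subset_rfl⟩).2
      exact absurd h (not_le.2 (by exact_mod_cast hlt))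

/-- sending a fuzzy matrix to the family of its weak `α`-cuts for
`α ∈ (0,1]` descends to a bijection from the quotient by Murali's equivalence onto the
nonempty chains of subsets of `Fin n × Fin n`; in particular the quotient is finite. -/
theorem stmt17 (n : ℕ) (hn : 1 ≤ n) :
    (∃ f : Quot (MuraliEquiv n) →
        {S : Set (Set (Fin n × Fin n)) // S.Nonempty ∧ IsChain (· ⊆ ·) S},
      Function.Bijective f ∧
        ∀ A, (f (Quot.mk _ A) : Set (Set (Fin n × Fin n))) =
          {s | ∃ α ∈ Set.Ioc (0 : ℝ) 1, s = {p | α ≤ A.1 p}}) ∧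
    Finite (Quot (MuraliEquiv n)) := by
  have key : ∃ f : Quot (MuraliEquiv n) →
        {S : Set (Set (Fin n × Fin n)) // S.Nonempty ∧ IsChain (· ⊆ ·) S},
      Function.Bijective f ∧
        ∀ A, (f (Quot.mk _ A) : Set (Set (Fin n × Fin n))) =
          {s | ∃ α ∈ Set.Ioc (0 : ℝ) 1, s = {p | α ≤ A.1 p}} := by
    refine ⟨Quot.lift (fun A => ⟨cutFamily A.1, cutFamily_nonempty _, cutFamily_chain _⟩)
      (fun A B h => Subtype.ext
        ((cutFamily_sub h).antisymm (cutFamily_sub h.symm'))), ⟨?_, ?_⟩, fun A => rfl⟩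
    · rintro ⟨A⟩ ⟨B⟩ h
      have h : cutFamily A.1 = cutFamily B.1 := congrArg Subtype.val h
      refine Quot.sound ⟨fun p q => ?_, fun p => ?_, fun p => ?_⟩
      · exact (lt_iff_cut A.2 p q).trans (by rw [h]; exact (lt_iff_cut B.2 p q).symm)
      · rw [one_iff_cut A.2, one_iff_cut B.2, h]
      · rw [zero_iff_cut A.2, zero_iff_cut B.2, h]
    · rintro ⟨S, hS, hc⟩
      obtain ⟨A, hA, h⟩ := cutFamily_surj S hS hc
      exact ⟨Quot.mk _ ⟨A, hA⟩, Subtype.ext h⟩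
  refine ⟨key, ?_⟩
  obtain ⟨f, hf, -⟩ := key
  exact Finite.of_injective f hf.1
end

section
/- The quotient of the set of fuzzy matrices of order 2 (functions Fin 2 × Fin 2 → ℝ with values in [0,1]) by Murali's equivalence relation has exactly 299 elements; that is, there are exactly 299 non-equivalent classes of fuzzy matrices of order 2. -/
/-- Canonical codes: interior levels in use form an initial segment of `1..4`. -/
def IsCode (f : Fin 2 × Fin 2 → Fin 6) : Prop :=
  ∀ p, 2 ≤ (f p).val → (f p).val < 5 → ∃ q, (f q).val + 1 = (f p).val

instance : DecidablePred IsCode := fun f => by unfold IsCode; infer_instance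

theorem card_code_quad : Fintype.card {x : Fin 6 × Fin 6 × Fin 6 × Fin 6 //
    ∀ a ∈ [x.1, x.2.1, x.2.2.1, x.2.2.2], 2 ≤ a.val → a.val < 5 →
      ∃ b ∈ [x.1, x.2.1, x.2.2.1, x.2.2.2], b.val + 1 = a.val} = 299 := by
  decide +kernel

theorem card_code : Nat.card {f // IsCode f} = 299 := by
  rw [← card_code_quad, ← Nat.card_eq_fintype_card]
  refine Nat.card_congr (Equiv.subtypeEquiv
    ⟨fun f => (f (0,0), f (0,1), f (1,0), f (1,1)),
     fun x p => if p = (0,0) then x.1 else if p = (0,1) then x.2.1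
       else if p = (1,0) then x.2.2.1 else x.2.2.2, ?_, ?_⟩ ?_)
  · intro f
    funext ⟨i, j⟩
    fin_cases i <;> fin_cases j <;> simp
  · rintro ⟨a, b, c, d⟩
    simp
  · intro f
    simp [IsCode, Prod.forall, Prod.exists, Fin.forall_fin_two, Fin.exists_fin_two, and_assoc,
      or_assoc]

theorem murali_equivalence (n : ℕ) : Equivalence (MuraliEquiv n) where
  refl A := ⟨fun _ _ => Iff.rfl, fun _ => Iff.rfl, fun _ => Iff.rfl⟩
  symm h := ⟨fun p q => (h.1 p q).symm, fun p => (h.2.1 p).symm, fun p => (h.2.2 p).symm⟩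
  trans h k := ⟨fun p q => (h.1 p q).trans (k.1 p q), fun p => (h.2.1 p).trans (k.2.1 p),
    fun p => (h.2.2 p).trans (k.2.2 p)⟩

/-- The fuzzy matrix of a code. -/
noncomputable def ofCode (f : Fin 2 × Fin 2 → Fin 6) :
    {A : Fin 2 × Fin 2 → ℝ // IsFuzzyMatrix 2 A} :=
  ⟨fun p => ((f p).val : ℝ) / 5, fun p => by
    have h : ((f p).val : ℝ) ≤ 5 := by exact_mod_cast Nat.le_of_lt_succ (f p).isLt
    constructor
    · positivity
    · linarith⟩

theorem ofCode_gt (f p q) : (ofCode f).1 p > (ofCode f).1 q ↔ (f q).val < (f p).val := by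
  simp only [ofCode, gt_iff_lt]
  rw [div_lt_div_iff_of_pos_right (by norm_num)]
  exact Nat.cast_lt

theorem ofCode_one (f p) : (ofCode f).1 p = 1 ↔ (f p).val = 5 := by
  simp only [ofCode]
  rw [div_eq_one_iff_eq (by norm_num)]
  exact_mod_cast Iff.rfl

theorem ofCode_zero (f p) : (ofCode f).1 p = 0 ↔ (f p).val = 0 := by
  simp [ofCode]

theorem code_le {f g : Fin 2 × Fin 2 → Fin 6} (hf : IsCode f)
    (h : MuraliEquiv 2 (ofCode f) (ofCode g)) :
    ∀ k p, (f p).val = k → k ≤ (g p).val := by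
  obtain ⟨h1, h2, h3⟩ := h
  simp only [ofCode_gt, ofCode_one, ofCode_zero] at h1 h2 h3
  intro k
  induction k with
  | zero => intros; omega
  | succ k ih =>
    intro p hp
    have a2 := h2 p
    have a3 := h3 p
    by_cases c : 2 ≤ (f p).val ∧ (f p).val < 5
    · obtain ⟨q, hq⟩ := hf p c.1 c.2
      have := ih q (by omega)
      have := h1 p q
      omega
    · have := (f p).isLt
      omega

/-- Positive levels of `A` that are at most `t`. -/
noncomputable def levels (A : Fin 2 × Fin 2 → ℝ) (t : ℝ) : Finset ℝ :=
  (Finset.univ.image A).filter (fun v => 0 < v ∧ v ≤ t)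

theorem mem_levels (A t v) : v ∈ levels A t ↔ (∃ q, A q = v) ∧ 0 < v ∧ v ≤ t := by
  simp [levels]

theorem levels_card (A t) : (levels A t).card ≤ 4 :=
  (Finset.card_filter_le _ _).trans (Finset.card_image_le.trans (by simp))

/-- The canonical code of a fuzzy matrix. -/
noncomputable def toCode (A : Fin 2 × Fin 2 → ℝ) (p : Fin 2 × Fin 2) : Fin 6 :=
  if A p = 1 then 5 else ⟨(levels A (A p)).card, by have := levels_card A (A p); omega⟩

theorem toCode_one {A p} (h : A p = 1) : (toCode A p).val = 5 := by simp [toCode, h]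

theorem toCode_ne {A p} (h : A p ≠ 1) : (toCode A p).val = (levels A (A p)).card := by
  simp [toCode, h]

theorem levels_mono (A) {s t : ℝ} (h : s ≤ t) : (levels A s).card ≤ (levels A t).card := by
  apply Finset.card_le_card
  intro v
  simp only [mem_levels]
  exact fun ⟨a, b, c⟩ => ⟨a, b, c.trans h⟩

theorem levels_strict (A) {p : Fin 2 × Fin 2} {s : ℝ} (h : s < A p) (h0 : 0 ≤ s) :
    (levels A s).card < (levels A (A p)).card := by
  apply Finset.card_lt_card
  rw [Finset.ssubset_iff_of_subset]
  · exact ⟨A p, (mem_levels _ _ _).2 ⟨⟨p, rfl⟩, by linarith, le_rfl⟩,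
      fun k => by have := ((mem_levels _ _ _).1 k).2.2; linarith⟩
  · intro v
    simp only [mem_levels]
    exact fun ⟨a, b, c⟩ => ⟨a, b, c.trans h.le⟩

theorem toCode_isCode {A} (hA : IsFuzzyMatrix 2 A) : IsCode (toCode A) := by
  intro p h2 h5
  have hp : A p ≠ 1 := fun h => by rw [toCode_one h] at h5; omega
  rw [toCode_ne hp] at h2 ⊢
  have hmem : A p ∈ levels A (A p) := by
    obtain ⟨v, hv⟩ := Finset.card_pos.1 (by omega : 0 < (levels A (A p)).card)
    rw [mem_levels] at hv ⊢
    exact ⟨⟨p, rfl⟩, by linarith, le_rfl⟩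
  have hc := Finset.card_erase_of_mem hmem
  have hne : ((levels A (A p)).erase (A p)).Nonempty := Finset.card_pos.1 (by omega)
  have hm := Finset.max'_mem _ hne
  have hmax : ∀ v ∈ (levels A (A p)).erase (A p), v ≤ ((levels A (A p)).erase (A p)).max' hne :=
    fun v hv => Finset.le_max' _ v hv
  generalize ((levels A (A p)).erase (A p)).max' hne = m at hm hmax
  rw [Finset.mem_erase, mem_levels] at hm
  obtain ⟨hmp, ⟨q, rfl⟩, hm0, hml⟩ := hm
  have hlt : A q < A p := lt_of_le_of_ne hml hmp
  refine ⟨q, ?_⟩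
  rw [toCode_ne (by have := (hA p).2; linarith : A q < 1).ne]
  have : levels A (A q) = (levels A (A p)).erase (A p) := by
    ext v
    constructor
    · intro hv
      rw [mem_levels] at hv
      rw [Finset.mem_erase, mem_levels]
      exact ⟨by linarith [hv.2.2] |> fun (h : v < A p) => h.ne, hv.1, hv.2.1, by linarith [hv.2.2]⟩
    · intro hv
      have := hmax v hv
      rw [Finset.mem_erase, mem_levels] at hv
      rw [mem_levels]
      exact ⟨hv.2.1, hv.2.2.1, this⟩
  rw [this, hc]
  omega

theorem toCode_equiv (A : {A : Fin 2 × Fin 2 → ℝ // IsFuzzyMatrix 2 A}) :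
    MuraliEquiv 2 (ofCode (toCode A.1)) A := by
  obtain ⟨A, hA⟩ := A
  refine ⟨fun p q => ?_, fun p => ?_, fun p => ?_⟩
  · rw [ofCode_gt]
    show _ ↔ A q < A p
    by_cases hq : A q = 1
    · have := (hA p).2
      have := (toCode A p).isLt
      rw [toCode_one hq]
      constructor
      · intro; omega
      · intro; linarith
    · rw [toCode_ne hq]
      by_cases hp : A p = 1
      · rw [toCode_one hp, hp]
        have := levels_card A (A q)
        exact ⟨fun _ => lt_of_le_of_ne (hA q).2 hq, fun _ => by omega⟩
      · rw [toCode_ne hp]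
        constructor
        · intro h
          by_contra hn
          have := levels_mono A (not_lt.1 hn)
          omega
        · exact fun h => levels_strict A h (hA q).1
  · rw [ofCode_one]
    show _ ↔ A p = 1
    by_cases hp : A p = 1
    · simp [toCode_one hp, hp]
    · rw [toCode_ne hp]
      have := levels_card A (A p)
      exact ⟨fun _ => by omega, fun h => absurd h hp⟩
  · rw [ofCode_zero]
    show _ ↔ A p = 0
    by_cases hp : A p = 1
    · simp [toCode_one hp, hp]
    · rw [toCode_ne hp]
      constructor
      · intro h
        by_contra hn
        have := levels_strict A (lt_of_le_of_ne (hA p).1 (Ne.symm hn)) le_rfl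
        omega
      · intro h
        rw [Finset.card_eq_zero, Finset.eq_empty_iff_forall_notMem]
        intro v hv
        have := (mem_levels _ _ _).1 hv
        linarith [this.2.1, this.2.2]

/-- there are exactly `299` non-equivalent classes of fuzzy matrices of
order `2`. -/
theorem stmt18 : Nat.card (Quot (MuraliEquiv 2)) = 299 := by
  rw [← card_code]
  symm
  refine Nat.card_congr (Equiv.ofBijective
    (fun f : {f // IsCode f} => Quot.mk (MuraliEquiv 2) (ofCode f.1)) ⟨?_, ?_⟩)
  · rintro ⟨f, hf⟩ ⟨g, hg⟩ h
    have h' := ((murali_equivalence 2).quot_mk_eq_iff _ _).1 h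
    apply Subtype.ext
    funext p
    exact Fin.ext (le_antisymm (code_le hf h' _ p rfl)
      (code_le hg ((murali_equivalence 2).symm h') _ p rfl))
  · intro x
    induction x using Quot.ind with
    | mk A => exact ⟨⟨toCode A.1, toCode_isCode A.2⟩, Quot.sound (toCode_equiv A)⟩
end
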